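/- arXiv:1401.1085 — 5 statements merged into one kernel-verified Lean document; each statement's English description precedes it below -/
import Mathlib

section
/- Let t > 1 and let a, b be points in the Euclidean plane. Let R₁ and R₂ be closed axis-aligned rectangles (with one side parallel to the segment ab) that lie between a and b, have their centers on the segment ab, both have width w (side parallel to ab) and height h, are separated (along the direction of ab) by a distance s ≥ ((t+1)/(t−1))·h, and with R₁ lying closer to a than R₂. Then for any points p ∈ R₁ and q ∈ R₂ one has t·|ap| + |pq| + t·|qb| ≤ t·|ab|. Concretely, with a = (0,0) and b = (L,0) with L > 0: if p = (p₁,p₂) and q = (q₁,q₂) satisfy 0 ≤ p₁ ≤ q₁ ≤ L, |p₂| ≤ h/2, |q₂| ≤ h/2 and q₁ − p₁ ≥ ((t+1)/(t−1))·h, then t·|ap| + |pq| + t·|qb| ≤ t·L. -/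
/-- Euclidean distance between two points of the plane `ℝ × ℝ`. -/
noncomputable def ed (p q : ℝ × ℝ) : ℝ :=
  Real.sqrt ((p.1 - q.1) ^ 2 + (p.2 - q.2) ^ 2)

/-- The Euclidean distance is at most the sum of bounds on the coordinate differences. -/
lemma ed_le_add {p q : ℝ × ℝ} {x y : ℝ} (hx : |p.1 - q.1| ≤ x) (hy : |p.2 - q.2| ≤ y) :
    ed p q ≤ x + y := by
  have hx₀ : 0 ≤ x := (abs_nonneg _).trans hx
  have hy₀ : 0 ≤ y := (abs_nonneg _).trans hy
  refine Real.sqrt_le_iff.mpr ⟨add_nonneg hx₀ hy₀, ?_⟩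
  nlinarith [sq_le_sq.mpr (hx.trans (le_abs_self x)), sq_le_sq.mpr (hy.trans (le_abs_self y)),
    mul_nonneg hx₀ hy₀]

/-- Lemma `nicebox`, concrete coordinates: with `a = (0,0)` and
`b = (L,0)`, if `p` lies in a rectangle of height `h` centered on `ab`, `q` lies in a
rectangle of height `h` centered on `ab` farther from `a`, both between `a` and `b`,
and they are horizontally separated by at least `((t+1)/(t-1))·h`, then
`t·|ap| + |pq| + t·|qb| ≤ t·|ab| = t·L`, i.e. `(p, q)` bridges `(a, b)`. -/
theorem bridging_rectangles (t L h : ℝ) (ht : 1 < t) (hL : 0 < L) (p q : ℝ × ℝ)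
    (hp1 : 0 ≤ p.1) (hpq1 : p.1 ≤ q.1) (hq1 : q.1 ≤ L)
    (hp2 : |p.2| ≤ h / 2) (hq2 : |q.2| ≤ h / 2)
    (hsep : (t + 1) / (t - 1) * h ≤ q.1 - p.1) :
    t * ed (0, 0) p + ed p q + t * ed q (L, 0) ≤ t * L := by
  have hap : ed (0, 0) p ≤ p.1 + h / 2 :=
    ed_le_add (by simp [abs_of_nonneg hp1]) (by simpa using hp2)
  have hpq : ed p q ≤ (q.1 - p.1) + h :=
    ed_le_add (by rw [abs_sub_comm, abs_of_nonneg (sub_nonneg.mpr hpq1)])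
      ((abs_sub _ _).trans (by linarith))
  have hqb : ed q (L, 0) ≤ (L - q.1) + h / 2 :=
    ed_le_add (by rw [abs_sub_comm, abs_of_nonneg (sub_nonneg.mpr hq1)]) (by simpa using hq2)
  have hwide : (t + 1) * h ≤ (q.1 - p.1) * (t - 1) := by
    rwa [div_mul_eq_mul_div, div_le_iff₀ (sub_pos.mpr ht)] at hsep
  have ht₀ : 0 ≤ t := by linarith
  linarith [mul_le_mul_of_nonneg_left hap ht₀, mul_le_mul_of_nonneg_left hqb ht₀]
end

section
/- Let t > 1, let a = (0,0) be the origin in ℝ², let ℓ be the positive x-axis, let 0 < α ≤ π/4, and let c_max, w, h > 0. Let R₁ = [x₁, x₁+w] × [−h/2, h/2] and R₂ = [x₁+w+s, x₁+2w+s] × [−h/2, h/2] be rectangles with x₁ ≥ h/2 (R₁ lies at least h/2 from a), every point of R₂ at distance at most c_max from a, and separation s ≥ √2·((t+1)/(t−1))·(2·sin(α)·c_max + h) + h. Let b ∈ ℝ² be any point with |ab| ≥ c_max + h/2 whose direction from a makes an angle at most α with the positive x-axis (i.e., b lies in the cone with apex a, bisector ℓ and angle 2α, at distance at least c_cone = c_max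 + h/2 from a). Then for any points p ∈ R₁ and q ∈ R₂ one has t·|ap| + |pq| + t·|qb| ≤ t·|ab|. -/
theorem ed_le_abs_add_abs (p q : ℝ × ℝ) : ed p q ≤ |p.1 - q.1| + |p.2 - q.2| := by
  refine Real.sqrt_le_iff.2 ⟨by positivity, ?_⟩
  nlinarith [sq_abs (p.1 - q.1), sq_abs (p.2 - q.2),
    mul_nonneg (abs_nonneg (p.1 - q.1)) (abs_nonneg (p.2 - q.2))]

theorem ed_le_abs_snd_add (q b : ℝ × ℝ) : ed q b ≤ |q.2| + ed (q.1, 0) b := by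
  have hE : 0 ≤ ed (q.1, 0) b := Real.sqrt_nonneg _
  have hsq : ed (q.1, 0) b ^ 2 = (q.1 - b.1) ^ 2 + (0 - b.2) ^ 2 :=
    Real.sq_sqrt (by positivity)
  have hb : |b.2| ≤ ed (q.1, 0) b := by
    refine abs_le_of_sq_le_sq ?_ hE
    nlinarith [sq_nonneg (q.1 - b.1)]
  refine Real.sqrt_le_iff.2 ⟨by positivity, ?_⟩
  have hmul : -(q.2 * b.2) ≤ |q.2| * ed (q.1, 0) b := by
    calc -(q.2 * b.2) ≤ |q.2 * b.2| := neg_le_abs _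
      _ = |q.2| * |b.2| := abs_mul _ _
      _ ≤ |q.2| * ed (q.1, 0) b := by gcongr
  nlinarith [sq_abs q.2]

/-- A point of the cone of half-angle `α` about the positive `x`-axis is closer to `(x, 0)` than
to the apex by at least `x - 2 x sin α`. -/
theorem ed_axis_le_of_mem_cone {α x : ℝ} {b : ℝ × ℝ} (hsin : 0 ≤ Real.sin α)
    (hcos : 0 ≤ Real.cos α) (hx : 0 ≤ x) (hxb : x ≤ ed (0, 0) b)
    (hangle : ed (0, 0) b * Real.cos α ≤ b.1) :
    ed (x, 0) b ≤ ed (0, 0) b - x + 2 * x * Real.sin α := by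
  have hsq : ed (0, 0) b ^ 2 = (0 - b.1) ^ 2 + (0 - b.2) ^ 2 := Real.sq_sqrt (by positivity)
  generalize ed (0, 0) b = d at *
  have hcs := Real.sin_sq_add_cos_sq α
  have hc1 := Real.cos_le_one α
  have hs1 := Real.sin_le_one α
  generalize Real.sin α = σ at *
  generalize Real.cos α = κ at *
  have hκ : 1 - κ ≤ σ ^ 2 := by nlinarith
  have hκ' : 1 - κ ≤ σ := by nlinarith
  have hdx : 0 ≤ d - x := sub_nonneg.2 hxb
  refine Real.sqrt_le_iff.2 ⟨by positivity, ?_⟩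
  have h1 : x * (d * κ) ≤ x * b.1 := by gcongr
  have h2 : x * (d - x) * (1 - κ) ≤ x * (d - x) * σ := by gcongr
  have h3 : x ^ 2 * (1 - κ) ≤ x ^ 2 * σ ^ 2 := by gcongr
  have h4 : 0 ≤ x * (d - x) * σ := by positivity
  have h5 : 0 ≤ x ^ 2 * σ ^ 2 := by positivity
  dsimp only
  linarith

/-- cone lemma, concrete coordinates: `a = (0,0)`, the bisector `ℓ`
is the positive `x`-axis, `0 < α ≤ π/4`, the rectangles are
`R₁ = [x₁, x₁+w] × [−h/2, h/2]` and `R₂ = [x₁+w+s, x₁+2w+s] × [−h/2, h/2]` with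
`x₁ ≥ h/2`, every point of `R₂` at distance at most `c_max` from `a`, and
`s ≥ √2·((t+1)/(t−1))·(2·sin α·c_max + h) + h`. Then for any `b` in the cone with apex
`a`, bisector `ℓ` and half-angle `α` (encoded by `b.1 ≥ cos α · |ab|`) at distance at
least `c_max + h/2` from `a`, and any `p ∈ R₁`, `q ∈ R₂`, the pair `(p, q)` bridges
`(a, b)`: `t·|ap| + |pq| + t·|qb| ≤ t·|ab|`. -/
theorem cone_bridging (t α cmax w h s x₁ : ℝ) (ht : 1 < t)
    (hα0 : 0 < α) (hα : α ≤ Real.pi / 4)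
    (hcmax : 0 < cmax) (hw : 0 < w) (hh : 0 < h)
    (hx₁ : h / 2 ≤ x₁)
    (hR2dist : ∀ r : ℝ × ℝ, x₁ + w + s ≤ r.1 → r.1 ≤ x₁ + 2 * w + s → |r.2| ≤ h / 2 →
      ed (0, 0) r ≤ cmax)
    (hs : Real.sqrt 2 * ((t + 1) / (t - 1)) * (2 * Real.sin α * cmax + h) + h ≤ s)
    (b : ℝ × ℝ) (hbfar : cmax + h / 2 ≤ ed (0, 0) b)
    (hangle : ed (0, 0) b * Real.cos α ≤ b.1)
    (p q : ℝ × ℝ)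
    (hp1 : x₁ ≤ p.1) (hp2 : p.1 ≤ x₁ + w) (hp3 : |p.2| ≤ h / 2)
    (hq1 : x₁ + w + s ≤ q.1) (hq2 : q.1 ≤ x₁ + 2 * w + s) (hq3 : |q.2| ≤ h / 2) :
    t * ed (0, 0) p + ed p q + t * ed q b ≤ t * ed (0, 0) b := by
  have hπ := Real.pi_pos
  have hsin : 0 < Real.sin α := Real.sin_pos_of_pos_of_lt_pi hα0 (by linarith)
  have hcos : 0 ≤ Real.cos α := Real.cos_nonneg_of_mem_Icc ⟨by linarith, by linarith⟩
  have ht' : 0 < t - 1 := by linarith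
  have hgap : (t + 1) * (2 * Real.sin α * cmax + h) ≤ (t - 1) * (s - h) := by
    have h2 : (1 : ℝ) ≤ Real.sqrt 2 := Real.one_le_sqrt.2 (by norm_num)
    have hnn : 0 ≤ (t + 1) * (2 * Real.sin α * cmax + h) := by positivity
    calc (t + 1) * (2 * Real.sin α * cmax + h)
        ≤ Real.sqrt 2 * ((t + 1) * (2 * Real.sin α * cmax + h)) := le_mul_of_one_le_left hnn h2
      _ = (t - 1) * (Real.sqrt 2 * ((t + 1) / (t - 1)) * (2 * Real.sin α * cmax + h)) := by
        field_simp
      _ ≤ (t - 1) * (s - h) := by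
        gcongr
        linarith
  have hs0 : 0 < s := by
    have : 0 < Real.sqrt 2 * ((t + 1) / (t - 1)) * (2 * Real.sin α * cmax + h) := by positivity
    linarith
  have hqc : q.1 ≤ cmax := by
    refine le_trans ?_ (hR2dist q hq1 hq2 hq3)
    refine Real.le_sqrt_of_sq_le ?_
    nlinarith [sq_nonneg q.2]
  have hq0 : 0 ≤ q.1 := by linarith
  have hap : ed (0, 0) p ≤ p.1 + h / 2 := by
    have hle := ed_le_abs_add_abs (0, 0) p
    simp only [zero_sub, abs_neg] at hle
    rw [abs_of_nonneg (by linarith : 0 ≤ p.1)] at hle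
    linarith
  have hpq : ed p q ≤ q.1 - p.1 + h := by
    have hle := ed_le_abs_add_abs p q
    rw [abs_of_nonpos (by linarith : p.1 - q.1 ≤ 0)] at hle
    have := abs_sub p.2 q.2
    linarith
  have hqb : ed q b ≤ ed (0, 0) b - q.1 + 2 * cmax * Real.sin α + h / 2 := by
    have hle := ed_le_abs_snd_add q b
    have haxis := ed_axis_le_of_mem_cone hsin.le hcos hq0 (by linarith) hangle
    have : 2 * q.1 * Real.sin α ≤ 2 * cmax * Real.sin α := by gcongr
    linarith
  have hsep : (t - 1) * s ≤ (t - 1) * (q.1 - p.1) := by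
    gcongr
    linarith
  have hcs : 0 ≤ cmax * Real.sin α := by positivity
  have hth : 0 ≤ (t - 1) * h := by positivity
  have htap := mul_le_mul_of_nonneg_left hap (by linarith : 0 ≤ t)
  have htqb := mul_le_mul_of_nonneg_left hqb (by linarith : 0 ≤ t)
  linarith
end

section
/- Let t > 1, λ > 0, and let P be a finite set of points in ℝ² that is λ-bridged. Then for every symmetric edge set E on P, the Euclidean graph G = (P, E) is a t-spanner if and only if every pair of points (a,b) with a, b ∈ P and |ab| ≤ λ has a t-path in G. -/
/-- The pair `(u, v)` has a `t`-path in the Euclidean graph `(P, E)`: a sequence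
`u = v₀, v₁, …, v_k = v` of points of `P` joined by edges of `E` whose total Euclidean
length is at most `t·|uv|`. -/
def HasTPath (P : Set (ℝ × ℝ)) (E : Set ((ℝ × ℝ) × (ℝ × ℝ))) (t : ℝ) (u v : ℝ × ℝ) :
    Prop :=
  ∃ (k : ℕ) (w : Fin (k + 1) → ℝ × ℝ),
    w 0 = u ∧ w (Fin.last k) = v ∧ (∀ i, w i ∈ P) ∧
    (∀ i : Fin k, (w i.castSucc, w i.succ) ∈ E) ∧
    ∑ i : Fin k, ed (w i.castSucc) (w i.succ) ≤ t * ed u v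

/-- `(p, q)` bridges `(a, b)`: `t·|ap| + |pq| + t·|qb| ≤ t·|ab|`. -/
def Bridges (t : ℝ) (p q a b : ℝ × ℝ) : Prop :=
  t * ed a p + ed p q + t * ed q b ≤ t * ed a b

/-- `(p, q)` is mandatory for `P`: the closed ellipse with foci `p, q` and
eccentricity `1/t` contains no point of `P` other than `p` and `q`. -/
def Mandatory (P : Set (ℝ × ℝ)) (t : ℝ) (p q : ℝ × ℝ) : Prop :=
  ∀ c ∈ P, ed p c + ed c q ≤ t * ed p q → c = p ∨ c = q

/-- `P` is `λ`-bridged: every pair of points of `P` at distance more than `λ` is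
bridged by some mandatory pair of points of `P`. -/
def IsBridged (P : Set (ℝ × ℝ)) (t lam : ℝ) : Prop :=
  ∀ a ∈ P, ∀ b ∈ P, lam < ed a b →
    ∃ p ∈ P, ∃ q ∈ P, p ≠ q ∧ p ≠ a ∧ p ≠ b ∧ q ≠ a ∧ q ≠ b ∧
      Mandatory P t p q ∧ Bridges t p q a b

/-- `WalkLength P E u v l`: there is a walk from `u` to `v` in the Euclidean graph `(P, E)`
of total length `l`. -/
inductive WalkLength (P : Set (ℝ × ℝ)) (E : Set ((ℝ × ℝ) × (ℝ × ℝ))) :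
    ℝ × ℝ → ℝ × ℝ → ℝ → Prop
  | nil {u : ℝ × ℝ} : u ∈ P → WalkLength P E u u 0
  | cons {u v w : ℝ × ℝ} {l : ℝ} :
      u ∈ P → (u, v) ∈ E → WalkLength P E v w l → WalkLength P E u w (ed u v + l)

theorem ed_nonneg (p q : ℝ × ℝ) : 0 ≤ ed p q := Real.sqrt_nonneg _

theorem ed_comm (p q : ℝ × ℝ) : ed p q = ed q p := by
  unfold ed
  congr 1
  ring

theorem ed_self (p : ℝ × ℝ) : ed p p = 0 := by
  simp [ed]

theorem ed_eq_dist (p q : ℝ × ℝ) : ed p q = dist (!₂[p.1, p.2]) (!₂[q.1, q.2]) := by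
  simp [ed, EuclideanSpace.dist_eq, Real.dist_eq, sq_abs]

theorem ed_triangle (p q r : ℝ × ℝ) : ed p r ≤ ed p q + ed q r := by
  simp only [ed_eq_dist]
  exact dist_triangle _ _ _

theorem ed_pos {p q : ℝ × ℝ} (h : p ≠ q) : 0 < ed p q := by
  rw [ed_eq_dist, dist_pos]
  intro h'
  apply h
  have h0 := congrArg (fun x => x.ofLp 0) h'
  have h1 := congrArg (fun x => x.ofLp 1) h'
  exact Prod.ext (by simpa using h0) (by simpa using h1)

namespace WalkLength

variable {P : Set (ℝ × ℝ)} {E : Set ((ℝ × ℝ) × (ℝ × ℝ))} {u v w : ℝ × ℝ} {l m t : ℝ}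

theorem start_mem (h : WalkLength P E u v l) : u ∈ P := by
  cases h <;> assumption

theorem ed_le (h : WalkLength P E u v l) : ed u v ≤ l := by
  induction h with
  | nil => exact (ed_self _).le
  | @cons u v w l _ _ _ ih => linarith [ed_triangle u v w]

theorem append (h : WalkLength P E u v l) (h' : WalkLength P E v w m) :
    WalkLength P E u w (l + m) := by
  induction h with
  | nil => simpa using h'
  | cons hu he _ ih =>
    rw [add_assoc]
    exact cons hu he (ih h')

theorem of_fin (k : ℕ) (f : Fin (k + 1) → ℝ × ℝ) (hP : ∀ i, f i ∈ P)
    (hE : ∀ i : Fin k, (f i.castSucc, f i.succ) ∈ E) :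
    WalkLength P E (f 0) (f (Fin.last k)) (∑ i : Fin k, ed (f i.castSucc) (f i.succ)) := by
  induction k with
  | zero => simpa using nil (hP 0)
  | succ k ih =>
    rw [Fin.sum_univ_succ]
    exact cons (hP 0) (hE 0) (ih (fun i => f i.succ) (fun i => hP _) (fun i => hE i.succ))

theorem exists_fin (h : WalkLength P E u v l) :
    ∃ (k : ℕ) (f : Fin (k + 1) → ℝ × ℝ), f 0 = u ∧ f (Fin.last k) = v ∧ (∀ i, f i ∈ P) ∧
      (∀ i : Fin k, (f i.castSucc, f i.succ) ∈ E) ∧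
      ∑ i : Fin k, ed (f i.castSucc) (f i.succ) = l := by
  induction h with
  | @nil u hu => exact ⟨0, fun _ => u, rfl, rfl, fun _ => hu, fun i => i.elim0, by simp⟩
  | @cons u v w l hu he _ ih =>
    obtain ⟨k, f, h0, hl, hP, hE, hs⟩ := ih
    refine ⟨k + 1, Fin.cons u f, rfl, ?_, ?_, ?_, ?_⟩
    · rw [← Fin.succ_last, Fin.cons_succ, hl]
    · intro i
      refine Fin.cases hu (fun j => ?_) i
      simpa using hP j
    · intro i
      refine Fin.cases ?_ (fun j => ?_) i
      · simpa [h0] using he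
      · simpa [← Fin.succ_castSucc] using hE j
    · rw [Fin.sum_univ_succ]
      simp [h0, hs]

/-- Every sufficiently short walk between the ends of a mandatory pair uses the edge
joining them. -/
theorem edge_mem_of_mandatory {p q : ℝ × ℝ} (h : WalkLength P E p q l) (hpq : p ≠ q)
    (hm : Mandatory P t p q) (hl : l ≤ t * ed p q) : (p, q) ∈ E := by
  induction h with
  | nil => exact absurd rfl hpq
  | @cons p v q l _ he hw ih =>
    rcases hm v hw.start_mem (by linarith [hw.ed_le]) with rfl | rfl
    · exact ih hpq hm (by linarith [ed_nonneg v v])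
    · exact he

end WalkLength

theorem hasTPath_iff_exists_walkLength {P : Set (ℝ × ℝ)} {E : Set ((ℝ × ℝ) × (ℝ × ℝ))}
    {t : ℝ} {u v : ℝ × ℝ} :
    HasTPath P E t u v ↔ ∃ l ≤ t * ed u v, WalkLength P E u v l := by
  constructor
  · rintro ⟨k, f, rfl, rfl, hP, hE, hs⟩
    exact ⟨_, hs, .of_fin k f hP hE⟩
  · rintro ⟨l, hl, h⟩
    obtain ⟨k, f, h0, hv, hP, hE, hs⟩ := h.exists_fin
    exact ⟨k, f, h0, hv, hP, hE, hs.trans_le hl⟩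

/-- A mandatory pair is strictly shorter than every pair of points of `P` it bridges. -/
theorem Mandatory.ed_lt_of_bridges {P : Set (ℝ × ℝ)} {t : ℝ} {p q a b : ℝ × ℝ} (ht : 1 < t)
    (hm : Mandatory P t p q) (hb : Bridges t p q a b) (ha : a ∈ P) (hpa : p ≠ a)
    (hqa : q ≠ a) : ed p q < ed a b := by
  unfold Bridges at hb
  have hout : t * ed p q < ed p a + ed a q := by
    by_contra! hle
    rcases hm a ha hle with h | h
    · exact hpa h.symm
    · exact hqa h.symm
  rw [ed_comm p a] at hout
  have htri := ed_triangle a b q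
  rw [ed_comm b q] at htri
  by_contra! hge
  have hmul : t * (t * ed p q) < t * (ed a p + ed a b + ed q b) :=
    mul_lt_mul_of_pos_left (by linarith) (by linarith)
  nlinarith [mul_nonneg (sq_nonneg (t - 1)) (ed_nonneg p q),
    mul_le_mul_of_nonneg_left hge (by linarith : (0 : ℝ) ≤ t)]

/-- Induction on the distance for pairs of points of a finite set. -/
theorem forall_mem_of_ed_lt_induction {P : Finset (ℝ × ℝ)} {s : ℝ × ℝ → ℝ × ℝ → Prop}
    (hs : ∀ a ∈ P, ∀ b ∈ P, (∀ c ∈ P, ∀ d ∈ P, ed c d < ed a b → s c d) → s a b) :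
    ∀ a ∈ P, ∀ b ∈ P, s a b := by
  classical
  by_contra! hbad
  obtain ⟨a, ha, b, hb, hab⟩ := hbad
  obtain ⟨x, hx, hmin⟩ := Finset.exists_min_image ((P ×ˢ P).filter fun x => ¬ s x.1 x.2)
    (fun x => ed x.1 x.2) ⟨(a, b), by simp [ha, hb, hab]⟩
  simp only [Finset.mem_filter, Finset.mem_product] at hx hmin
  refine hx.2 (hs x.1 hx.1.1 x.2 hx.1.2 fun c hc d hd hlt => ?_)
  by_contra hcd
  exact absurd (hmin (c, d) ⟨⟨hc, hd⟩, hcd⟩) hlt.not_ge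

/-- if a finite point set `P` is `λ`-bridged, then for any symmetric
edge set `E` on `P`, the graph `(P, E)` is a `t`-spanner if and only if all pairs of
points at distance at most `λ` have a `t`-path. -/
theorem bridged_local_spanner_characterization (t lam : ℝ) (ht : 1 < t) (hlam : 0 < lam)
    (P : Finset (ℝ × ℝ)) (E : Set ((ℝ × ℝ) × (ℝ × ℝ)))
    (hEsym : ∀ u v, (u, v) ∈ E → (v, u) ∈ E)
    (hEP : ∀ e ∈ E, e.1 ∈ P ∧ e.2 ∈ P)
    (hbr : IsBridged (↑P) t lam) :
    (∀ a ∈ P, ∀ b ∈ P, HasTPath (↑P) E t a b) ↔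
      (∀ a ∈ P, ∀ b ∈ P, ed a b ≤ lam → HasTPath (↑P) E t a b) := by
  refine ⟨fun h a ha b hb _ => h a ha b hb, fun hloc => ?_⟩
  refine forall_mem_of_ed_lt_induction fun a ha b hb ih => ?_
  rcases le_or_gt (ed a b) lam with hle | hlt
  · exact hloc a ha b hb hle
  obtain ⟨p, hp, q, hq, hpq, hpa, -, hqa, -, hm, hbr⟩ := hbr a ha b hb hlt
  have hpos := ed_pos hpq
  have hap : ed a p < ed a b := by
    unfold Bridges at hbr
    nlinarith [mul_nonneg (by linarith : (0 : ℝ) ≤ t) (ed_nonneg q b)]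
  have hqb : ed q b < ed a b := by
    unfold Bridges at hbr
    nlinarith [mul_nonneg (by linarith : (0 : ℝ) ≤ t) (ed_nonneg a p)]
  have h1 := ih a ha p hp hap
  have h2 := ih p hp q hq (hm.ed_lt_of_bridges ht hbr ha hpa hqa)
  have h3 := ih q hq b hb hqb
  rw [hasTPath_iff_exists_walkLength] at h1 h2 h3 ⊢
  obtain ⟨l, hl, w1⟩ := h1
  obtain ⟨m, hm', w2⟩ := h2
  obtain ⟨n, hn, w3⟩ := h3
  refine ⟨l + (ed p q + n), ?_,
    w1.append (.cons hp (w2.edge_mem_of_mandatory hpq hm hm') w3)⟩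
  unfold Bridges at hbr
  linarith
end

section
/- Let t > 1, h > 0, c_max > 0 and let α, β be angles with 0 ≤ β ≤ α ≤ π/4. If s ≥ √2·((t+1)/(t−1))·(2·sin(α)·c_max + h) + h, then cos(β)·s − h·sin(β) ≥ ((t+1)/(t−1))·(2·sin(β)·c_max + h). -/
/-- key estimate in the cone-bridging lemma: for `t > 1`,
`h, c_max > 0` and angles `0 ≤ β ≤ α ≤ π/4`, if
`s ≥ √2·((t+1)/(t−1))·(2·sin α·c_max + h) + h`, then
`cos β·s − h·sin β ≥ ((t+1)/(t−1))·(2·sin β·c_max + h)`. -/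
theorem separation_estimate (t h cmax α β s : ℝ) (ht : 1 < t) (hh : 0 < h)
    (hc : 0 < cmax) (hβ0 : 0 ≤ β) (hβα : β ≤ α) (hα : α ≤ Real.pi / 4)
    (hs : Real.sqrt 2 * ((t + 1) / (t - 1)) * (2 * Real.sin α * cmax + h) + h ≤ s) :
    (t + 1) / (t - 1) * (2 * Real.sin β * cmax + h) ≤
      Real.cos β * s - h * Real.sin β := by
  have hπ := Real.pi_pos
  have hK : 0 ≤ (t + 1) / (t - 1) := div_nonneg (by linarith) (by linarith)
  have hsin : Real.sin β ≤ Real.sin α :=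
    Real.sin_le_sin_of_le_of_le_pi_div_two (by linarith) (by linarith) hβα
  have hsinα : 0 ≤ Real.sin α := Real.sin_nonneg_of_nonneg_of_le_pi (by linarith) (by linarith)
  have hcos : √2 / 2 ≤ Real.cos β := by
    rw [← Real.cos_pi_div_four]
    exact Real.cos_le_cos_of_nonneg_of_le_pi hβ0 (by linarith) (by linarith)
  have hsin_le : Real.sin β ≤ √2 / 2 := by
    rw [← Real.sin_pi_div_four]
    exact Real.sin_le_sin_of_le_of_le_pi_div_two (by linarith) (by linarith) (by linarith)
  have hcos0 : 0 ≤ Real.cos β := le_trans (by positivity) hcos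
  have hone : 1 ≤ Real.cos β * √2 := by
    nlinarith [Real.sq_sqrt (show (0 : ℝ) ≤ 2 by norm_num), Real.sqrt_nonneg 2]
  have hmono : (t + 1) / (t - 1) * (2 * Real.sin β * cmax + h) ≤
      (t + 1) / (t - 1) * (2 * Real.sin α * cmax + h) := by gcongr
  have hscale : (t + 1) / (t - 1) * (2 * Real.sin α * cmax + h) ≤
      Real.cos β * √2 * ((t + 1) / (t - 1) * (2 * Real.sin α * cmax + h)) :=
    le_mul_of_one_le_left (by positivity) hone
  have hcos_s := mul_le_mul_of_nonneg_left hs hcos0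
  have hsin_cos : h * Real.sin β ≤ h * Real.cos β :=
    mul_le_mul_of_nonneg_left (hsin_le.trans hcos) hh.le
  linarith
end

section
/- Let t > 1 and w, h, s > 0, and set X = (h + 2w + t·h)/(2(t−1)). Let d = (−X, 0) and e = (2w + s + X, 0), and let a ∈ [0, w] × [−h/2, h/2] and b ∈ [w+s, 2w+s] × [−h/2, h/2]. Then every point c ∈ ℝ² with |ac| + |cb| ≤ t·|ab| satisfies |dc| + |ce| ≤ t·|de|. In other words, the closed ellipse with foci a, b and eccentricity 1/t is contained in the closed ellipse with foci d, e and eccentricity 1/t. -/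
theorem abs_fst_sub_le_ed (p q : ℝ × ℝ) : |p.1 - q.1| ≤ ed p q :=
  Real.abs_le_sqrt (le_add_of_nonneg_right (sq_nonneg _))

/-- let `t > 1`, `w, h, s > 0`, `X = (h + 2w + t·h)/(2(t−1))`,
`d = (−X, 0)`, `e = (2w + s + X, 0)`. For any `a ∈ [0,w] × [−h/2,h/2]` and
`b ∈ [w+s, 2w+s] × [−h/2,h/2]`, every point `c` of the closed ellipse with foci
`a, b` and eccentricity `1/t` lies in the closed ellipse with foci `d, e` and
eccentricity `1/t`: if `|ac| + |cb| ≤ t·|ab|` then `|dc| + |ce| ≤ t·|de|`. -/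
theorem ellipse_in_ellipse (t w h s X : ℝ) (ht : 1 < t) (hw : 0 < w) (hh : 0 < h)
    (hs : 0 < s) (hX : X = (h + 2 * w + t * h) / (2 * (t - 1)))
    (a b c : ℝ × ℝ)
    (ha1 : 0 ≤ a.1) (ha2 : a.1 ≤ w) (ha3 : |a.2| ≤ h / 2)
    (hb1 : w + s ≤ b.1) (hb2 : b.1 ≤ 2 * w + s) (hb3 : |b.2| ≤ h / 2)
    (hc : ed a c + ed c b ≤ t * ed a b) :
    ed (-X, 0) c + ed c (2 * w + s + X, 0) ≤ t * ed (-X, 0) (2 * w + s + X, 0) := by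
  have hX2 : 2 * X * (t - 1) = h + 2 * w + t * h := by
    have : t - 1 ≠ 0 := by linarith
    rw [hX]
    field_simp
  have hXpos : 0 < X := by
    rw [hX]
    have : 0 < t - 1 := by linarith
    positivity
  obtain ⟨ha3l, ha3r⟩ := abs_le.1 ha3
  obtain ⟨hb3l, hb3r⟩ := abs_le.1 hb3
  have hda : ed (-X, 0) a ≤ X + a.1 + h / 2 := by
    refine (ed_le_abs_add_abs _ _).trans (add_le_add ?_ ?_) <;>
      exact abs_le.2 ⟨by dsimp only; linarith, by dsimp only; linarith⟩
  have hbe : ed b (2 * w + s + X, 0) ≤ 2 * w + s + X - b.1 + h / 2 := by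
    refine (ed_le_abs_add_abs _ _).trans (add_le_add ?_ ?_) <;>
      exact abs_le.2 ⟨by dsimp only; linarith, by dsimp only; linarith⟩
  have hab : ed a b ≤ b.1 - a.1 + h := by
    refine (ed_le_abs_add_abs _ _).trans (add_le_add ?_ ?_) <;>
      exact abs_le.2 ⟨by linarith, by linarith⟩
  have hde : 2 * X + 2 * w + s ≤ ed (-X, 0) (2 * w + s + X, 0) := by
    have := (neg_le_abs _).trans (abs_fst_sub_le_ed (-X, 0) (2 * w + s + X, 0))
    dsimp only at this
    linarith
  have hdc := ed_triangle (-X, 0) a c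
  have hce := ed_triangle c b (2 * w + s + X, 0)
  have hab' := mul_le_mul_of_nonneg_left hab (by linarith : 0 ≤ t)
  have hde' := mul_le_mul_of_nonneg_left hde (by linarith : 0 ≤ t)
  have hwidth : 0 ≤ (t - 1) * (2 * w + s - (b.1 - a.1)) :=
    mul_nonneg (by linarith) (by linarith)
  linarith
end
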